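/- Liouville's Theorem: Let (F, D) be a differential field of characteristic zero whose field of constants C := Const(F) is algebraically closed. Suppose f ∈ F has an elementary integral over (F, D), i.e., there is a differential field extension (E, D) of (F, D) with the same field of constants C, obtained as a tower F = E_0 ⊆ E_1 ⊆ … ⊆ E_n = E where each E_i = E_{i−1}(t_i) and t_i is either algebraic over E_{i−1}, or satisfies D(t_i) = D(a)/a for some nonzero a ∈ E_{i−1} (a logarithm), or satisfies D(t_i) = t_i·D(a) for some a ∈ E_{i−1} (an exponential), and there exists g ∈ E with D(g) = f. Then there exist v ∈ F, n ∈ ℕ, constants c_1, …, c_n ∈ C, and nonzero elements u_1, …, u_n ∈ F such that f = D(v) + Σ_{i=1}^n c_i · D(u_i)/u_i. -/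

import Mathlib

section

open Differential IntermediateField Polynomial

namespace LaurentSeries

variable {K : Type*} [Field K]

/-- The additive endomorphism of `K⸨X⸩` acting on the coefficient of `X ^ n` by `d n`. -/
noncomputable def mapCoeffs (d : ℤ → K →+ K) : LaurentSeries K →+ LaurentSeries K where
  toFun x := ⟨fun n ↦ d n (x.coeff n), x.isPWO_support.mono fun n hn h ↦ hn (by simp [h])⟩
  map_zero' := by ext; simp
  map_add' x y := by ext; simp

@[simp]
lemma coeff_mapCoeffs (d : ℤ → K →+ K) (x : LaurentSeries K) (n : ℤ) :
    (mapCoeffs d x).coeff n = d n (x.coeff n) := rfl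

lemma mapCoeffs_mul {d : ℤ → K →+ K}
    (hd : ∀ i j a b, d (i + j) (a * b) = a * d j b + b * d i a) (x y : LaurentSeries K) :
    mapCoeffs d (x * y) = x * mapCoeffs d y + y * mapCoeffs d x := by
  have hsupp (z : LaurentSeries K) : (mapCoeffs d z).support ⊆ z.support :=
    fun n hn h ↦ hn (by simp [h])
  ext n
  rw [mul_comm y, HahnSeries.coeff_add, HahnSeries.coeff_mul_right' y.isPWO_support (hsupp y),
    HahnSeries.coeff_mul_left' x.isPWO_support (hsupp x), coeff_mapCoeffs, HahnSeries.coeff_mul,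
    map_sum, ← Finset.sum_add_distrib]
  refine Finset.sum_congr rfl fun ij hij ↦ ?_
  obtain ⟨-, -, rfl⟩ := Finset.mem_antidiagonal.mp hij
  simp [hd, mul_comm]

lemma coeff_div_of_order_le {x y : LaurentSeries K} (h : ∀ j < y.order, x.coeff j = 0) :
    (∀ j < 0, (x / y).coeff j = 0) ∧ (x / y).coeff 0 = x.coeff y.order / y.coeff y.order := by
  obtain rfl | hx := eq_or_ne x 0
  · simp
  obtain rfl | hy := eq_or_ne y 0
  · simp
  obtain ⟨q, rfl⟩ : ∃ q, x = q * y := ⟨x / y, by field_simp⟩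
  have hq : q ≠ 0 := left_ne_zero_of_mul hx
  rw [mul_div_cancel_right₀ _ hy]
  have h0 : 0 ≤ q.order := by
    by_contra! hlt
    refine HahnSeries.coeff_order_eq_zero.not.mpr hx (h _ ?_)
    rw [HahnSeries.order_mul hq hy]
    lia
  refine ⟨fun j hj ↦ HahnSeries.coeff_eq_zero_of_lt_order (hj.trans_le h0), ?_⟩
  have hy0 : y.coeff y.order ≠ 0 := HahnSeries.coeff_order_eq_zero.not.mpr hy
  rw [eq_div_iff hy0]
  obtain h0 | h0 := h0.eq_or_lt
  · have := HahnSeries.coeff_mul_order_add_order q y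
    rw [← h0, zero_add] at this
    rw [this, HahnSeries.leadingCoeff_eq, HahnSeries.leadingCoeff_eq, ← h0]
  · rw [HahnSeries.coeff_eq_zero_of_lt_order h0, zero_mul, HahnSeries.coeff_eq_zero_of_lt_order]
    rw [HahnSeries.order_mul hq hy]
    lia

variable [Differential K]

/-- The derivation of `K⸨X⸩` extending the one of `K` with `X′ = b * X ^ k * X`,
as an additive map. -/
noncomputable def extendDeriv (k : ℕ) (b : K) : LaurentSeries K →+ LaurentSeries K :=
  mapCoeffs (fun _ ↦ (Differential.deriv (R := K)).toLinearMap.toAddMonoidHom) +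
    (AddMonoidHom.mulLeft (HahnSeries.single (k : ℤ) b)).comp
      (mapCoeffs fun n ↦ AddMonoidHom.mulLeft (n : K))

lemma extendDeriv_mul (k : ℕ) (b : K) (x y : LaurentSeries K) :
    extendDeriv k b (x * y) = x * extendDeriv k b y + y * extendDeriv k b x := by
  simp only [extendDeriv, AddMonoidHom.add_apply, AddMonoidHom.comp_apply,
    AddMonoidHom.coe_mulLeft]
  rw [mapCoeffs_mul (fun _ _ a b ↦ by simp), mapCoeffs_mul (fun i j a b ↦ by simp; ring)]
  ring

lemma coeff_extendDeriv (k : ℕ) (b : K) (x : LaurentSeries K) (n : ℤ) :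
    (extendDeriv k b x).coeff n =
      (x.coeff n)′ + b * ((n - k : ℤ) * x.coeff (n - k)) := by
  simp [extendDeriv, HahnSeries.coeff_single_mul]

lemma extendDeriv_C (k : ℕ) (b a : K) :
    extendDeriv k b (HahnSeries.C a) = HahnSeries.C a′ := by
  ext n
  rw [coeff_extendDeriv, HahnSeries.C_apply, HahnSeries.C_apply, HahnSeries.coeff_single,
    HahnSeries.coeff_single, HahnSeries.coeff_single]
  split_ifs with hn hk hk <;> simp [hk]

lemma extendDeriv_inv (k : ℕ) (b : K) (x : LaurentSeries K) :
    extendDeriv k b x⁻¹ = -extendDeriv k b x / x ^ 2 := by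
  obtain rfl | hx := eq_or_ne x 0
  · simp
  have h := extendDeriv_mul k b x x⁻¹
  rw [mul_inv_cancel₀ hx, ← map_one HahnSeries.C, extendDeriv_C, Derivation.map_one_eq_zero,
    map_zero] at h
  field_simp at h ⊢
  linear_combination -h

lemma extendDeriv_X (k : ℕ) (b : K) :
    extendDeriv k b (HahnSeries.single 1 1) =
      HahnSeries.C b * HahnSeries.single 1 1 ^ k * HahnSeries.single 1 1 := by
  ext n
  rw [coeff_extendDeriv, HahnSeries.C_apply, mul_assoc, ← pow_succ, HahnSeries.single_pow]
  simp only [HahnSeries.coeff_single, nsmul_eq_mul, mul_one, one_pow]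
  obtain rfl | hk := eq_or_ne n (k + 1)
  · simp [apply_ite]
  · have hk' : n - k ≠ 1 := by lia
    simp [hk, hk', apply_ite]

lemma coeff_extendDeriv_div_self (k : ℕ) (b : K) (x : LaurentSeries K) :
    (∀ j < 0, (extendDeriv k b x / x).coeff j = 0) ∧
      (extendDeriv k b x / x).coeff 0 =
        Differential.logDeriv (x.coeff x.order) + (if k = 0 then b else 0) * x.order := by
  have hlt (j) (hj : j < x.order) : x.coeff j = 0 := HahnSeries.coeff_eq_zero_of_lt_order hj
  obtain rfl | hx := eq_or_ne x 0
  · simp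
  have hx0 : x.coeff x.order ≠ 0 := HahnSeries.coeff_order_eq_zero.not.mpr hx
  refine (coeff_div_of_order_le fun j hj ↦ ?_).imp id fun h ↦ h.trans ?_
  · rw [coeff_extendDeriv, hlt j hj, hlt (j - k) (by lia)]
    simp
  · rw [coeff_extendDeriv, Differential.logDeriv]
    split_ifs with hk
    · subst hk
      simp
      field_simp
    · rw [hlt (x.order - k) (by lia)]
      simp

end LaurentSeries

section Extension

open scoped RatFunc

variable {K E : Type*} [Field K] [Differential K] [Field E] [Differential E] [Algebra K E]
  [DifferentialAlgebra K E]

/-- If `t′ ∈ K(t)` then `K(t)` is closed under the derivation. -/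
lemma deriv_mem_adjoin_simple {t : E} (ht : t′ ∈ K⟮t⟯) {x : E} (hx : x ∈ K⟮t⟯) : x′ ∈ K⟮t⟯ := by
  induction hx using adjoin_induction with
  | mem x hx => rwa [Set.mem_singleton_iff.mp hx]
  | algebraMap x => rw [deriv_algebraMap]; exact IntermediateField.algebraMap_mem _ _
  | add x y hx hy hx' hy' => rw [map_add]; exact add_mem hx' hy'
  | inv x hx hx' =>
    rw [Derivation.leibniz_inv, smul_eq_mul]
    exact mul_mem (neg_mem (pow_mem (inv_mem hx) 2)) hx'
  | mul x y hx hy hx' hy' =>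
    rw [Derivation.leibniz, smul_eq_mul, smul_eq_mul]
    exact add_mem (mul_mem hx hy') (mul_mem hy hx')

/-- If `w` is transcendental over `K` with `w′ = b * w ^ k * w`, then expansion in powers of `w`
is a differential embedding of `K(w)` into `K⸨X⸩`. -/
lemma exists_laurentSeries_embedding {w : E} (hw : Transcendental K w) (k : ℕ) (b : K)
    (hwd : w′ = algebraMap K E b * w ^ k * w) :
    ∃ φ : K⟮w⟯ →+* LaurentSeries K, (∀ a, φ (algebraMap K _ a) = HahnSeries.C a) ∧
      ∀ x : K⟮w⟯, ∃ y : K⟮w⟯, (y : E) = (x : E)′ ∧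
        φ y = LaurentSeries.extendDeriv k b (φ x) := by
  let e := RatFunc.algEquivOfTranscendental w hw
  let φ : K⟮w⟯ →+* LaurentSeries K := (algebraMap (RatFunc K) _).comp (e.symm : K⟮w⟯ →+* RatFunc K)
  have hC (a : K) : φ (algebraMap K _ a) = HahnSeries.C a := by
    have : e.symm (algebraMap K _ a) = algebraMap K (RatFunc K) a := e.symm.commutes a
    simp only [φ, RingHom.comp_apply, RingHom.coe_coe, this]
    rw [IsScalarTower.algebraMap_apply K K[X] (RatFunc K), ← IsScalarTower.algebraMap_apply]
    simp
  have hX : φ (AdjoinSimple.gen K w) = HahnSeries.single 1 1 := by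
    have : e.symm (AdjoinSimple.gen K w) = RatFunc.X := by
      rw [AlgEquiv.symm_apply_eq]
      ext
      simp [e]
    simp only [φ, RingHom.comp_apply, RingHom.coe_coe, this, RatFunc.coe_X]
  refine ⟨φ, hC, fun ⟨x, hx⟩ ↦ ?_⟩
  induction hx using adjoin_induction with
  | mem x hx =>
    obtain rfl := Set.mem_singleton_iff.mp hx
    refine ⟨algebraMap K _ b * AdjoinSimple.gen K x ^ k * AdjoinSimple.gen K x, ?_, ?_⟩
    · simp [hwd]
    · rw [map_mul, map_mul, map_pow, hC, hX]
      exact (LaurentSeries.extendDeriv_X k b).symm.trans (by rw [← hX]; rfl)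
  | algebraMap a =>
    refine ⟨algebraMap K _ a′, (deriv_algebraMap a).symm, ?_⟩
    rw [hC, ← LaurentSeries.extendDeriv_C, ← hC]
    rfl
  | add x y hx hy hx' hy' =>
    obtain ⟨x', hx', hφx⟩ := hx'
    obtain ⟨y', hy', hφy⟩ := hy'
    refine ⟨x' + y', by simp [hx', hy'], ?_⟩
    rw [map_add, hφx, hφy, ← map_add, ← map_add]
    rfl
  | inv x hx hx' =>
    obtain ⟨x', hx', hφx⟩ := hx'
    refine ⟨-x' / ⟨x, hx⟩ ^ 2, ?_, ?_⟩
    · simp [hx', Derivation.leibniz_inv]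
      ring
    · rw [map_div₀, map_neg, map_pow, hφx, ← LaurentSeries.extendDeriv_inv, ← map_inv₀]
      rfl
  | mul x y hx hy hx' hy' =>
    obtain ⟨x', hx', hφx⟩ := hx'
    obtain ⟨y', hy', hφy⟩ := hy'
    refine ⟨⟨x, hx⟩ * y' + ⟨y, hy⟩ * x', by simp [hx', hy'], ?_⟩
    rw [map_add, map_mul, map_mul, hφx, hφy, ← LaurentSeries.extendDeriv_mul, ← map_mul]
    rfl

/-- Expanding an identity `a = ∑ cᵢ * logDeriv uᵢ + v′` over `K(w)` in powers of `w`: the negative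
coefficients of `v′` vanish, and the constant coefficients give an identity over `K`. -/
lemma exists_laurentSeries_of_eq_sum_logDeriv {w : E} (hw : Transcendental K w) (k : ℕ) (b : K)
    (hwd : w′ = algebraMap K E b * w ^ k * w) {ι : Type*} [Fintype ι] (a : K) (c : ι → K)
    (u : ι → E) (hu : ∀ i, u i ∈ K⟮w⟯) (v : E) (hv : v ∈ K⟮w⟯)
    (h : algebraMap K E a = ∑ i, algebraMap K E (c i) * Differential.logDeriv (u i) + v′) :
    ∃ (u₀ : ι → K) (n : ι → ℤ) (V : LaurentSeries K),
      (∀ j < 0, (LaurentSeries.extendDeriv k b V).coeff j = 0) ∧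
      a = ∑ i, c i * (Differential.logDeriv (u₀ i) + (if k = 0 then b else 0) * n i) +
        (LaurentSeries.extendDeriv k b V).coeff 0 := by
  obtain ⟨φ, hC, hφ⟩ := exists_laurentSeries_embedding hw k b hwd
  choose d hd hφd using hφ
  let u' (i : ι) : K⟮w⟯ := ⟨u i, hu i⟩
  have h' : algebraMap K K⟮w⟯ a =
      ∑ i, algebraMap K K⟮w⟯ (c i) * (d (u' i) / u' i) + d ⟨v, hv⟩ := by
    apply (algebraMap K⟮w⟯ E).injective
    simp only [map_add, map_sum, map_mul, map_div₀, ← IsScalarTower.algebraMap_apply]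
    simp only [IntermediateField.algebraMap_apply, hd]
    exact h
  apply_fun φ at h'
  simp only [map_add, map_sum, map_mul, map_div₀, hC, hφd] at h'
  have hcoeff (j : ℤ) := congrArg (fun x ↦ HahnSeries.coeff x j) h'
  simp only [HahnSeries.coeff_add, HahnSeries.coeff_sum, HahnSeries.C_apply,
    HahnSeries.coeff_single_zero_mul] at hcoeff
  refine ⟨fun i ↦ (φ (u' i)).coeff (φ (u' i)).order, fun i ↦ (φ (u' i)).order, φ ⟨v, hv⟩,
    fun j hj ↦ ?_, ?_⟩
  · have := hcoeff j
    rw [Finset.sum_eq_zero fun i _ ↦ by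
      rw [(LaurentSeries.coeff_extendDeriv_div_self k b _).1 j hj, mul_zero],
      HahnSeries.coeff_single_of_ne hj.ne, zero_add] at this
    exact this.symm
  · have := hcoeff 0
    simpa only [HahnSeries.coeff_single_same,
      (LaurentSeries.coeff_extendDeriv_div_self k b _).2] using this

/-- An identity `a = ∑ cᵢ * logDeriv uᵢ + v′` over `K(t)` with `t` a transcendental exponential
descends to `K`. -/
lemma exists_eq_sum_logDeriv_of_exponential {t : E} (ht : Transcendental K t) (b : K)
    (htd : t′ = t * (algebraMap K E b)′) {ι : Type*} [Fintype ι] (a : K) (c : ι → K)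
    (hc : ∀ i, (c i)′ = 0) (u : ι → E) (hu : ∀ i, u i ∈ K⟮t⟯) (v : E) (hv : v ∈ K⟮t⟯)
    (h : algebraMap K E a = ∑ i, algebraMap K E (c i) * Differential.logDeriv (u i) + v′) :
    ∃ (u₀ : ι → K) (v₀ : K), a = ∑ i, c i * Differential.logDeriv (u₀ i) + v₀′ := by
  obtain ⟨u₀, n, V, -, h0⟩ := exists_laurentSeries_of_eq_sum_logDeriv ht 0 b′
    (by rw [htd, deriv_algebraMap]; ring) a c u hu v hv h
  refine ⟨u₀, V.coeff 0 + ∑ i, c i * n i * b, ?_⟩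
  simp only [LaurentSeries.coeff_extendDeriv, if_true] at h0
  simp only [h0, map_add, map_sum, Derivation.leibniz, hc, smul_eq_mul, mul_add,
    Finset.sum_add_distrib]
  simp [mul_assoc, mul_comm]
  ring

/-- An identity `a = ∑ cᵢ * logDeriv uᵢ + v′` over `K(t)` with `t` a transcendental logarithm
descends to `K`. -/
lemma exists_eq_sum_logDeriv_of_logarithm [CharZero K] [ContainConstants K E] {t : E}
    (ht : Transcendental K t) (b : K)
    (htd : t′ = Differential.logDeriv (algebraMap K E b)) {ι : Type*} [Fintype ι] (a : K)
    (c : ι → K) (hc : ∀ i, (c i)′ = 0) (u : ι → E) (hu : ∀ i, u i ∈ K⟮t⟯) (v : E) (hv : v ∈ K⟮t⟯)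
    (h : algebraMap K E a = ∑ i, algebraMap K E (c i) * Differential.logDeriv (u i) + v′) :
    ∃ (c₀ : Option ι → K) (u₀ : Option ι → K) (v₀ : K), (∀ i, (c₀ i)′ = 0) ∧
      a = ∑ i, c₀ i * Differential.logDeriv (u₀ i) + v₀′ := by
  have htd' : t′ = algebraMap K E (Differential.logDeriv b) := by
    rw [htd, Differential.logDeriv_algebraMap]
  have hadj : K⟮t⁻¹⟯ = K⟮t⟯ := by
    refine le_antisymm ?_ ?_ <;> rw [adjoin_simple_le_iff]
    · exact inv_mem (mem_adjoin_simple_self K t)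
    · simpa using inv_mem (mem_adjoin_simple_self K t⁻¹)
  have hno (y : K) : y′ ≠ Differential.logDeriv b := by
    intro hy
    obtain ⟨z, hz⟩ := mem_range_of_deriv_eq_zero K (x := t - algebraMap K E y)
      (by rw [map_sub, htd', deriv_algebraMap, hy, sub_self])
    refine ht ?_
    rw [← sub_add_cancel t (algebraMap K E y), ← hz, ← map_add]
    exact isAlgebraic_algebraMap _
  rw [← hadj] at hv
  simp_rw [← hadj] at hu
  obtain ⟨u₀, n, V, hneg, h0⟩ := exists_laurentSeries_of_eq_sum_logDeriv
    (w := t⁻¹) (by rwa [Transcendental, IsAlgebraic.inv_iff]) 1 (-Differential.logDeriv b)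
    (by rw [Derivation.leibniz_inv, htd', map_neg]; simp; ring) a c u hu v hv h
  simp only [LaurentSeries.coeff_extendDeriv] at hneg h0
  have hlt (j) (hj : j < V.order) : V.coeff j = 0 := HahnSeries.coeff_eq_zero_of_lt_order hj
  have hconst : (V.coeff (-1))′ = 0 := by
    obtain hV | hV := lt_or_ge (-1) V.order
    · rw [hlt _ hV, map_zero]
    obtain hV | hV := hV.eq_or_lt
    · simpa [hlt (-2) (by lia)] using hneg (-1) (by simp)
    exfalso
    have hV0 : V.coeff V.order ≠ 0 := by
      refine HahnSeries.coeff_order_eq_zero.not.mpr ?_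
      rintro rfl
      simp at hV
    have hm : (V.order : K) ≠ 0 := Int.cast_ne_zero.mpr (by lia)
    have hlead : (V.coeff V.order)′ = 0 := by
      simpa [hlt (V.order - 1) (by lia)] using hneg V.order (by lia)
    have hnext := hneg (V.order + 1) (by lia)
    simp only [Nat.cast_one, add_sub_cancel_right] at hnext
    have hdm : ((V.order : K) * V.coeff V.order)′ = 0 := by simp [hlead]
    refine hno (V.coeff (V.order + 1) / (V.order * V.coeff V.order)) ?_
    rw [Derivation.leibniz_div, hdm]
    simp only [smul_eq_mul]
    field_simp
    linear_combination V.order * V.coeff V.order * hnext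
  refine ⟨fun i ↦ i.elim (V.coeff (-1)) c, fun i ↦ i.elim b u₀, V.coeff 0, ?_, ?_⟩
  · rintro (_ | i)
    · exact hconst
    · exact hc i
  · rw [h0, Fintype.sum_option]
    simp
    ring

lemma exists_eq_sum_logDeriv_of_algebraic [CharZero K] {t : E} (ht : IsAlgebraic K t)
    {ι : Type} [Fintype ι] (a : K) (c : ι → K) (hc : ∀ i, (c i)′ = 0) (u : ι → E)
    (hu : ∀ i, u i ∈ K⟮t⟯) (v : E) (hv : v ∈ K⟮t⟯)
    (h : algebraMap K E a = ∑ i, algebraMap K E (c i) * Differential.logDeriv (u i) + v′) :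
    ∃ (ι₀ : Type) (_ : Fintype ι₀) (c₀ : ι₀ → K) (_ : ∀ i, (c₀ i)′ = 0) (u₀ : ι₀ → K) (v₀ : K),
      a = ∑ i, c₀ i * Differential.logDeriv (u₀ i) + v₀′ := by
  have : FiniteDimensional K K⟮t⟯ := adjoin.finiteDimensional ht.isIntegral
  refine IsLiouville.isLiouville (K := K⟮t⟯) a ι c hc (fun i ↦ ⟨u i, hu i⟩) ⟨v, hv⟩ ?_
  apply (algebraMap K⟮t⟯ E).injective
  simp only [map_add, map_sum, map_mul, ← Differential.logDeriv_algebraMap, ← deriv_algebraMap]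
  exact h

/-- The generator `t` of `K(t)` is algebraic, a logarithm or an exponential over `K`. -/
def IsElementaryGenerator (K : Type*) {E : Type*} [Field K] [Field E] [Differential E]
    [Algebra K E] (t : E) : Prop :=
  IsAlgebraic K t ∨ (∃ b : K, t′ = Differential.logDeriv (algebraMap K E b)) ∨
    ∃ b : K, t′ = t * (algebraMap K E b)′

lemma IsElementaryGenerator.deriv_mem_adjoin [CharZero K] {t : E}
    (ht : IsElementaryGenerator K t) : t′ ∈ K⟮t⟯ := by
  obtain ht | ⟨b, hb⟩ | ⟨b, hb⟩ := ht
  · have : FiniteDimensional K K⟮t⟯ := adjoin.finiteDimensional ht.isIntegral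
    have := deriv_algebraMap (B := E) (AdjoinSimple.gen K t)
    rw [AdjoinSimple.algebraMap_gen] at this
    rw [this]
    exact SetLike.coe_mem _
  · rw [hb, Differential.logDeriv_algebraMap]
    exact IntermediateField.algebraMap_mem _ _
  · rw [hb, deriv_algebraMap]
    exact mul_mem (mem_adjoin_simple_self K t) (IntermediateField.algebraMap_mem _ _)

lemma IsElementaryGenerator.exists_eq_sum_logDeriv [CharZero K] [ContainConstants K E] {t : E}
    (ht : IsElementaryGenerator K t) {ι : Type} [Fintype ι] (a : K) (c : ι → K)
    (hc : ∀ i, (c i)′ = 0) (u : ι → E) (hu : ∀ i, u i ∈ K⟮t⟯) (v : E) (hv : v ∈ K⟮t⟯)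
    (h : algebraMap K E a = ∑ i, algebraMap K E (c i) * Differential.logDeriv (u i) + v′) :
    ∃ (ι₀ : Type) (_ : Fintype ι₀) (c₀ : ι₀ → K) (_ : ∀ i, (c₀ i)′ = 0) (u₀ : ι₀ → K) (v₀ : K),
      a = ∑ i, c₀ i * Differential.logDeriv (u₀ i) + v₀′ := by
  by_cases hta : IsAlgebraic K t
  · exact exists_eq_sum_logDeriv_of_algebraic hta a c hc u hu v hv h
  obtain ⟨b, hb⟩ | ⟨b, hb⟩ := ht.resolve_left hta
  · obtain ⟨c₀, u₀, v₀, hc₀, h₀⟩ :=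
      exists_eq_sum_logDeriv_of_logarithm hta b hb a c hc u hu v hv h
    exact ⟨Option ι, inferInstance, c₀, hc₀, u₀, v₀, h₀⟩
  · obtain ⟨u₀, v₀, h₀⟩ := exists_eq_sum_logDeriv_of_exponential hta b hb a c hc u hu v hv h
    exact ⟨ι, inferInstance, c, hc, u₀, v₀, h₀⟩

end Extension

section Subfield

lemma adjoin_simple_toSubfield {E : Type*} [Field E] (S : Subfield E) (t : E) :
    (S⟮t⟯).toSubfield = Subfield.closure ((S : Set E) ∪ {t}) := by
  rw [adjoin_toSubfield]
  congr 2
  exact Subtype.range_val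

variable {E : Type*} [Field E] [Differential E]

/-- The restriction of a derivation to a subfield closed under it. -/
@[reducible]
def Subfield.differential (S : Subfield E) (hS : ∀ x ∈ S, x′ ∈ S) : Differential S where
  deriv := Derivation.mk'
    (AddMonoidHom.mk' (fun x : S ↦ (⟨(x : E)′, hS x x.2⟩ : S))
      fun x y ↦ Subtype.ext (by simp)).toIntLinearMap
    fun x y ↦ Subtype.ext (by simp)

/-- `a` can be written as `∑ cᵢ * logDeriv uᵢ + v′` with `cᵢ` constant and `uᵢ, v ∈ S`. -/
def HasLiouvilleForm (S : Subfield E) (a : E) : Prop :=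
  ∃ (ι : Type) (_ : Fintype ι) (c u : ι → E) (v : E), (∀ i, (c i)′ = 0) ∧ (∀ i, u i ∈ S) ∧
    v ∈ S ∧ a = ∑ i, c i * Differential.logDeriv (u i) + v′

lemma deriv_mem_closure [CharZero E] {S : Subfield E} (hS : ∀ x ∈ S, x′ ∈ S) {t : E}
    (ht : IsElementaryGenerator S t) {x : E} (hx : x ∈ Subfield.closure ((S : Set E) ∪ {t})) :
    x′ ∈ Subfield.closure ((S : Set E) ∪ {t}) := by
  let := S.differential hS
  have : DifferentialAlgebra S E := ⟨fun _ ↦ rfl⟩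
  rw [← adjoin_simple_toSubfield] at hx ⊢
  exact deriv_mem_adjoin_simple ht.deriv_mem_adjoin hx

lemma HasLiouvilleForm.of_closure [CharZero E] {S : Subfield E} (hS : ∀ x ∈ S, x′ ∈ S)
    (hconst : ∀ x : E, x′ = 0 → x ∈ S) {t : E} (ht : IsElementaryGenerator S t) {a : E}
    (ha : a ∈ S) (h : HasLiouvilleForm (Subfield.closure ((S : Set E) ∪ {t})) a) :
    HasLiouvilleForm S a := by
  let := S.differential hS
  have : DifferentialAlgebra S E := ⟨fun _ ↦ rfl⟩
  have : ContainConstants S E := ⟨fun {x} hx ↦ ⟨⟨x, hconst x hx⟩, rfl⟩⟩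
  obtain ⟨ι, _, c, u, v, hc, hu, hv, h⟩ := h
  rw [← adjoin_simple_toSubfield] at hv
  simp_rw [← adjoin_simple_toSubfield] at hu
  obtain ⟨ι₀, _, c₀, hc₀, u₀, v₀, h₀⟩ := ht.exists_eq_sum_logDeriv ⟨a, ha⟩
    (fun i ↦ ⟨c i, hconst _ (hc i)⟩) (fun i ↦ Subtype.ext (hc i)) u hu v hv h
  refine ⟨ι₀, inferInstance, fun i ↦ c₀ i, fun i ↦ u₀ i, v₀, fun i ↦ congrArg Subtype.val (hc₀ i),
    fun i ↦ (u₀ i).2, v₀.2, ?_⟩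
  have := congrArg (algebraMap S E) h₀
  simp only [map_add, map_sum, map_mul, ← Differential.logDeriv_algebraMap,
    ← deriv_algebraMap] at this
  exact this

/-- Liouville's theorem for a tower of subfields: a Liouville form over the top descends to the
bottom. -/
lemma HasLiouvilleForm.of_tower [CharZero E] {N : ℕ} (S : Fin (N + 1) → Subfield E) (t : Fin N → E)
    (hS : ∀ x ∈ S 0, x′ ∈ S 0) (hconst : ∀ x : E, x′ = 0 → x ∈ S 0)
    (hadjoin : ∀ i : Fin N, S i.succ = Subfield.closure ((S i.castSucc : Set E) ∪ {t i}))
    (ht : ∀ i : Fin N, IsElementaryGenerator (S i.castSucc) (t i)) {a : E} (ha : a ∈ S 0)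
    (h : HasLiouvilleForm (S (Fin.last N)) a) : HasLiouvilleForm (S 0) a := by
  have hmono (i : Fin N) : S i.castSucc ≤ S i.succ := by
    rw [hadjoin]
    exact fun x hx ↦ Subfield.subset_closure (Or.inl hx)
  have hle (i : Fin (N + 1)) : S 0 ≤ S i := by
    induction i using Fin.induction with
    | zero => exact le_rfl
    | succ i ih => exact ih.trans (hmono i)
  have hderiv (i : Fin (N + 1)) : ∀ x ∈ S i, x′ ∈ S i := by
    induction i using Fin.induction with
    | zero => exact hS
    | succ i ih =>
      rw [hadjoin]
      exact fun x hx ↦ deriv_mem_closure ih (ht i) hx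
  refine Fin.reverseInduction (motive := fun i ↦ HasLiouvilleForm (S i) a) h (fun i hi ↦ ?_) 0
  rw [hadjoin] at hi
  exact hi.of_closure (hderiv _) (fun x hx ↦ hle _ (hconst x hx)) (ht i) (hle _ ha)

end Subfield

end


/-- **Liouville's Theorem.**
Let `(F, D)` be a differential field of characteristic zero whose field of constants
`C = Const(F)` is algebraically closed. Suppose `f ∈ F` has an elementary integral over
`(F, D)`: there is a differential field extension `(E, DE)` of `(F, D)` with the same
constants, built as a tower `F = E₀ ⊆ E₁ ⊆ … ⊆ Eₙ = E` where `E_{i+1} = E_i(t_i)` and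
each `t_i` is algebraic over `E_i`, a logarithm over `E_i` (i.e. `DE t_i = DE a / a` for
some nonzero `a ∈ E_i`), or an exponential over `E_i` (i.e. `DE t_i = t_i * DE a` for
some `a ∈ E_i`), and there is `g ∈ E` with `DE g = ι f`. Then there are `v ∈ F`,
constants `c_1, …, c_n` and nonzero `u_1, …, u_n ∈ F` with
`f = D v + ∑ i, c_i * D u_i / u_i`. -/
theorem liouville_theorem
    {F : Type} [Field F] [CharZero F]
    (D : F → F)
    (hDadd : ∀ a b : F, D (a + b) = D a + D b)
    (hDmul : ∀ a b : F, D (a * b) = a * D b + b * D a)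
    -- the field of constants is algebraically closed:
    (halgcl : ∀ p : Polynomial F, 0 < p.degree → (∀ i : ℕ, D (p.coeff i) = 0) →
      ∃ x : F, D x = 0 ∧ p.eval x = 0)
    (f : F)
    -- the elementary extension (E, DE) of (F, D):
    (E : Type) [Field E] (ι : F →+* E) (DE : E → E)
    (hDEadd : ∀ a b : E, DE (a + b) = DE a + DE b)
    (hDEmul : ∀ a b : E, DE (a * b) = a * DE b + b * DE a)
    (hext : ∀ a : F, DE (ι a) = ι (D a))
    -- same field of constants:
    (hconst : ∀ x : E, DE x = 0 → ∃ c : F, D c = 0 ∧ ι c = x)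
    -- the tower structure F = E₀ ⊆ E₁ ⊆ … ⊆ Eₙ = E:
    (N : ℕ) (Es : Fin (N + 1) → Subfield E) (t : Fin N → E)
    (hE0 : Es 0 = ι.fieldRange)
    (hEtop : Es (Fin.last N) = ⊤)
    (hadjoin : ∀ i : Fin N,
      Es i.succ = Subfield.closure ((Es i.castSucc : Set E) ∪ {t i}))
    (helem : ∀ i : Fin N,
      (∃ p : Polynomial E, p ≠ 0 ∧ (∀ j : ℕ, p.coeff j ∈ Es i.castSucc) ∧
        p.eval (t i) = 0) ∨
      (∃ a ∈ Es i.castSucc, a ≠ 0 ∧ DE (t i) = DE a / a) ∨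
      (∃ a ∈ Es i.castSucc, DE (t i) = t i * DE a))
    -- f has an integral in E:
    (hint : ∃ g : E, DE g = ι f) :
    ∃ (v : F) (n : ℕ) (c : Fin n → F) (u : Fin n → F),
      (∀ i, D (c i) = 0) ∧ (∀ i, u i ≠ 0) ∧
      f = D v + ∑ i, c i * D (u i) / u i := by
  let : Differential F :=
    ⟨Derivation.mk' (AddMonoidHom.mk' D hDadd).toIntLinearMap hDmul⟩
  let : Differential E :=
    ⟨Derivation.mk' (AddMonoidHom.mk' DE hDEadd).toIntLinearMap hDEmul⟩
  have : CharZero E := charZero_of_injective_ringHom ι.injective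
  obtain ⟨g, hg⟩ := hint
  have helem' (i : Fin N) : IsElementaryGenerator (Es i.castSucc) (t i) := by
    obtain ⟨p, hp, hcoeff, hroot⟩ | ⟨a, ha, -, hta⟩ | ⟨a, ha, hta⟩ := helem i
    · have hlift : p ∈ Polynomial.lifts (algebraMap (Es i.castSucc) E) :=
        (Polynomial.lifts_iff_coeff_lifts p).mpr fun j ↦ ⟨⟨_, hcoeff j⟩, rfl⟩
      obtain ⟨q, rfl⟩ := (Polynomial.mem_lifts p).mp hlift
      refine .inl ⟨q, fun hq ↦ hp (by rw [hq, Polynomial.map_zero]), ?_⟩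
      rwa [Polynomial.aeval_def, ← Polynomial.eval_map]
    · exact .inr (.inl ⟨⟨a, ha⟩, hta⟩)
    · exact .inr (.inr ⟨⟨a, ha⟩, hta⟩)
  have htop : HasLiouvilleForm (Es (Fin.last N)) (ι f) :=
    ⟨Empty, inferInstance, nofun, nofun, g, nofun, nofun, by simp [hEtop], by simpa using! hg.symm⟩
  obtain ⟨κ, _, c, u, v, hc, hu, hv, h⟩ := htop.of_tower Es t
    (by rw [hE0]; rintro _ ⟨x, rfl⟩; exact ⟨D x, (hext x).symm⟩)
    (by rw [hE0]; intro x hx; obtain ⟨y, -, hy⟩ := hconst x hx; exact ⟨y, hy⟩)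
    hadjoin helem' (by rw [hE0]; exact ⟨f, rfl⟩)
  simp only [hE0] at hu hv
  obtain ⟨v₀, rfl⟩ := hv
  choose u₀ hu₀ using hu
  choose c₀ hc₀ hιc₀ using fun i ↦ hconst (c i) (hc i)
  have hD1 : D 1 = 0 := (Differential.deriv (R := F)).map_one_eq_zero
  classical
  let e := Fintype.equivFin κ
  refine ⟨v₀, Fintype.card κ, fun i ↦ c₀ (e.symm i),
    fun i ↦ if u₀ (e.symm i) = 0 then 1 else u₀ (e.symm i), fun i ↦ hc₀ _, fun i ↦ ?_, ?_⟩
  · dsimp only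
    split_ifs with hi
    exacts [one_ne_zero, hi]
  · apply ι.injective
    rw [h, add_comm, map_add, map_sum, ← e.symm.sum_comp]
    refine congrArg₂ (· + ·) (hext v₀) (Finset.sum_congr rfl fun i _ ↦ ?_)
    rw [← hu₀, ← hιc₀]
    dsimp only
    split_ifs with hi
    · simp [hi, hD1]
    · rw [Differential.logDeriv, mul_div_assoc, map_mul, map_div₀]
      exact congrArg (fun x ↦ ι (c₀ (e.symm i)) * (x / ι (u₀ (e.symm i)))) (hext _)
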